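/- Weighted Cellular Matrix-Tree Theorem, part (1): Let d ≥ 1 and let X be a d-dimensional combinatorial cell structure that is APC. Let R = ℤ[x_f : f ∈ X_d] (multivariate polynomial ring with one indeterminate per d-cell), let ∂̂_d be the matrix over R obtained from ∂_d by multiplying the column indexed by each f ∈ X_d by x_f, let L̂ = ∂̂_d ∂̂_d^T, and let τ̂_d(X) = Σ_{T a spanning d-tree of X} |H_{d−1}(X_T)|² ∏_{f∈T} x_f² ∈ R. Set r = |X_d| − β_d(X). Then the coefficient c of y^{|X_{d−1}| − r} in the characteristic polynomial det(y·I − L̂) ∈ R[y] satisfies c · |H_{d−2}(X)|² = (−1)^r · τ̂_d(X) · τ_{d−1}(X) (an equality in R; equivalently, the product π̂_d of the nonzero eigenvalues of L̂ equals τ̂_d(X)·τ_{d−1}(X)/|H_{d−2}(X)|²). -/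

import Mathlib

open BigOperators Matrix

/-- A `d`-dimensional combinatorial cell structure: nonempty finite sets of `i`-cells
(of sizes `c i`, with `c i = 0` for `i > d`) together with integer boundary matrices
`D i` (the matrix of `∂_{i+1}`), satisfying `∂ ∘ ∂ = 0` and the condition that every
column of `∂_1 = D 0` sums to zero. -/
structure CellStructure (d : ℕ) where
  c : ℕ → ℕ
  c_pos : ∀ i, i ≤ d → 0 < c i
  c_zero : ∀ i, d < i → c i = 0
  D : (i : ℕ) → Matrix (Fin (c i)) (Fin (c (i + 1))) ℤ
  dd : ∀ i, D i * D (i + 1) = 0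
  colsum : ∀ j, ∑ i, D 0 i j = 0

namespace CellStructure

variable {d : ℕ} (X : CellStructure d)

/-- The augmentation map `ε : ℤ^{X_0} → ℤ`. -/
def aug : (Fin (X.c 0) → ℤ) →ₗ[ℤ] ℤ where
  toFun v := ∑ i, v i
  map_add' u v := by simp [Finset.sum_add_distrib]
  map_smul' r v := by simp [Finset.mul_sum]

/-- The rational augmentation map. -/
def augQ : (Fin (X.c 0) → ℚ) →ₗ[ℚ] ℚ where
  toFun v := ∑ i, v i
  map_add' u v := by simp [Finset.sum_add_distrib]
  map_smul' r v := by simp [Finset.mul_sum]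

/-- `bdry i` is the boundary map `∂_{i+1} : C_{i+1} → C_i`. -/
def bdry (i : ℕ) : (Fin (X.c (i + 1)) → ℤ) →ₗ[ℤ] (Fin (X.c i) → ℤ) :=
  Matrix.toLin' (X.D i)

/-- Reduced cycles: `Zker i = ker ∂_i` (with `∂_0 = ε` the augmentation). -/
def Zker : (i : ℕ) → Submodule ℤ (Fin (X.c i) → ℤ)
  | 0 => LinearMap.ker X.aug
  | (i + 1) => LinearMap.ker (X.bdry i)

/-- Rational reduced cycles: kernel of `∂_i ⊗ ℚ`. -/
def ZkerQ : (i : ℕ) → Submodule ℚ (Fin (X.c i) → ℚ)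
  | 0 => LinearMap.ker X.augQ
  | (i + 1) => LinearMap.ker (Matrix.toLin' ((X.D i).map (Int.cast : ℤ → ℚ)))

/-- Reduced homology `H_i(X) = ker ∂_i / im ∂_{i+1}` for `i ≥ 0`. -/
abbrev H (i : ℕ) : Type :=
  X.Zker i ⧸ (LinearMap.range (X.bdry i)).comap (X.Zker i).subtype

/-- `Hred j` is the reduced homology in dimension `j - 1`; in particular
`Hred 0 = H_{-1}(X) = ℤ / im ε`. -/
def Hred : ℕ → Type
  | 0 => ℤ ⧸ LinearMap.range X.aug
  | (i + 1) => X.H i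

/-- `β_i(X)`, the rank of the `i`-th reduced homology group. -/
noncomputable def beta (i : ℕ) : ℕ := Module.finrank ℤ (X.H i)

/-- `X` is acyclic in positive codimension. -/
def APC : Prop := ∀ i, i < d → X.beta i = 0

/-- The span of the columns of `∂_{j+1}` indexed by `T`. -/
def colSpan (j : ℕ) (T : Finset (Fin (X.c (j + 1)))) : Submodule ℤ (Fin (X.c j) → ℤ) :=
  Submodule.span ℤ ((fun t => (X.D j)ᵀ t) '' (T : Set (Fin (X.c (j + 1)))))

/-- For `T ⊆ X_{j+1}`, the homology group `H_j(X_T)` of the subcomplex `X_T`. -/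
abbrev Hsub (j : ℕ) (T : Finset (Fin (X.c (j + 1)))) : Type :=
  X.Zker j ⧸ (X.colSpan j T).comap (X.Zker j).subtype

/-- `HsubG k T` is `H_{k-1}(X_T)` for `T ⊆ X_k`; for `k = 0` this is
`H_{-1}(X_T) = ℤ / (ℤ-span of the entries of ε on T)` (all of which equal `1`). -/
def HsubG : (k : ℕ) → Finset (Fin (X.c k)) → Type
  | 0, T => ℤ ⧸ Submodule.span ℤ ((fun _v => (1 : ℤ)) '' (T : Set (Fin (X.c 0))))
  | (j + 1), T => X.Hsub j T

/-- `T ⊆ X_{j+1}` is a cellular spanning `(j+1)`-tree of `X`. -/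
def IsTree (j : ℕ) (T : Finset (Fin (X.c (j + 1)))) : Prop :=
  LinearIndependent ℤ (fun t : {f // f ∈ T} => (X.D j)ᵀ (t : Fin (X.c (j + 1))))
    ∧ Nat.card (X.Hsub j T) ≠ 0
    ∧ T.card = Module.finrank ℚ (X.ZkerQ j)

/-- `IsTreeG k T` : `T ⊆ X_k` is a cellular spanning `k`-tree of `X`; a spanning
`0`-tree is a single vertex. -/
def IsTreeG : (k : ℕ) → Finset (Fin (X.c k)) → Prop
  | 0, T => LinearIndependent ℤ (fun _t : {f // f ∈ T} => (1 : ℤ))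
      ∧ Nat.card (ℤ ⧸ Submodule.span ℤ ((fun _v => (1 : ℤ)) '' (T : Set (Fin (X.c 0))))) ≠ 0
      ∧ T.card = 1
  | (j + 1), T => X.IsTree j T

open Classical in
/-- The torsion-weighted spanning tree enumerators `τ_k(X)`, with `τ_0(X) = |X_0|`. -/
noncomputable def tau : ℕ → ℕ
  | 0 => X.c 0
  | (j + 1) => ∑ T : Finset (Fin (X.c (j + 1))),
      if X.IsTree j T then (Nat.card (X.Hsub j T)) ^ 2 else 0

/-- The real boundary matrix of `∂_{i+1}`. -/
noncomputable def Dr (i : ℕ) : Matrix (Fin (X.c i)) (Fin (X.c (i + 1))) ℝ :=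
  (X.D i).map (Int.cast : ℤ → ℝ)

/-- The up-down Laplacian `L^ud_i = ∂_{i+1} ∂_{i+1}^T` as a real matrix. -/
noncomputable def Lud (i : ℕ) : Matrix (Fin (X.c i)) (Fin (X.c i)) ℝ :=
  X.Dr i * (X.Dr i)ᴴ

theorem Lud_isHermitian (i : ℕ) : (X.Lud i).IsHermitian :=
  Matrix.isHermitian_mul_conjTranspose_self _

/-- `π_k(X)`: the product of the nonzero eigenvalues of `L^ud_{k-1}` for `k ≥ 1`,
and `π_0(X) = |X_0|`. -/
noncomputable def piNZ : ℕ → ℝ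
  | 0 => (X.c 0 : ℝ)
  | (j + 1) => ∏ i, (if (X.Lud_isHermitian j).eigenvalues i = 0 then 1
      else (X.Lud_isHermitian j).eigenvalues i)

end CellStructure

namespace CellStructure

variable {e : ℕ} (X : CellStructure (e + 1))

/-- The weighted boundary matrix `∂̂_d` over `R = ℤ[x_f : f ∈ X_d]`: the column of each
`d`-cell `f` is multiplied by the indeterminate `x_f`. -/
noncomputable def wD :
    Matrix (Fin (X.c e)) (Fin (X.c (e + 1))) (MvPolynomial (Fin (X.c (e + 1))) ℤ) :=
  Matrix.of fun i f => (X.D e i f : MvPolynomial (Fin (X.c (e + 1))) ℤ) * MvPolynomial.X f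

/-- The weighted up-down Laplacian `L̂ = ∂̂_d ∂̂_d^T`. -/
noncomputable def wLud :
    Matrix (Fin (X.c e)) (Fin (X.c e)) (MvPolynomial (Fin (X.c (e + 1))) ℤ) :=
  X.wD * (X.wD)ᵀ

open Classical in
/-- The weighted spanning tree enumerator
`τ̂_d(X) = Σ_{T a spanning d-tree} |H_{d-1}(X_T)|² ∏_{f ∈ T} x_f²`. -/
noncomputable def wtau : MvPolynomial (Fin (X.c (e + 1))) ℤ :=
  ∑ T : Finset (Fin (X.c (e + 1))),
    if X.IsTree e T then
      (Nat.card (X.Hsub e T) : MvPolynomial (Fin (X.c (e + 1))) ℤ) ^ 2 *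
        ∏ f ∈ T, (MvPolynomial.X f) ^ 2
    else 0

end CellStructure

theorem Matrix.det_mul_eq_sum_det_mul_det {m n R : Type*} [Fintype m] [DecidableEq m]
    [Fintype n] [DecidableEq n] [CommRing R] (A : Matrix m n R) (B : Matrix n m R)
    (f : Finset n → m → n)
    (hf : ∀ T : Finset n, T.card = Fintype.card m →
      Function.Injective (f T) ∧ Finset.univ.image (f T) = T) :
    (A * B).det = ∑ T ∈ Finset.univ.powersetCard (Fintype.card m),
      (A.submatrix id (f T)).det * (B.submatrix (f T) id).det := by
  have h1 : (A * B).det = ∑ p : m → n, (∏ i, A i (p i)) * (B.submatrix p id).det := by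
    have := (Matrix.detRowAlternating (R := R) (n := m)).toMultilinearMap.map_sum
      (fun i (j : n) => A i j • B j)
    have h2 : (A * B) = fun i => ∑ j, A i j • B j := by
      ext i k
      simp [Matrix.mul_apply]
    rw [h2]
    refine this.trans (Finset.sum_congr rfl fun p _ => ?_)
    rw [MultilinearMap.map_smul_univ]
    rfl
  have h0 : ∀ p : m → n, ¬ Function.Injective p → (B.submatrix p id).det = 0 := by
    intro p hp
    simp only [Function.Injective, not_forall] at hp
    obtain ⟨i, j, hij, hne⟩ := hp
    exact Matrix.det_zero_of_row_eq hne (by ext k; simp [hij])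
  rw [h1, ← Finset.sum_filter_of_ne (p := Function.Injective)
    (fun p _ hp => by_contra fun h => hp (by rw [h0 p h, mul_zero]))]
  rw [← Finset.sum_fiberwise_of_maps_to (t := Finset.univ.powersetCard (Fintype.card m))
    (g := fun p : m → n => Finset.univ.image p) (fun p hp => by
      rw [Finset.mem_powersetCard]
      exact ⟨Finset.subset_univ _, Finset.card_image_of_injective _ (Finset.mem_filter.1 hp).2⟩)]
  refine Finset.sum_congr rfl fun T hT => ?_
  obtain ⟨hinj, himg⟩ := hf T (Finset.mem_powersetCard.1 hT).2
  have h3 : (A.submatrix id (f T)).det * (B.submatrix (f T) id).det =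
      ∑ σ : Equiv.Perm m, (∏ i, A i (f T (σ i))) * (B.submatrix (f T ∘ σ) id).det := by
    rw [← Matrix.det_transpose, Matrix.det_apply', Finset.sum_mul]
    refine Finset.sum_congr rfl fun σ _ => ?_
    have : B.submatrix (f T ∘ σ) id = (B.submatrix (f T) id).submatrix σ id := by
      ext; rfl
    rw [this, Matrix.det_permute]
    simp only [transpose_apply, submatrix_apply, id_eq]
    ring
  rw [h3]
  symm
  refine Finset.sum_bij (fun σ _ => f T ∘ σ) ?_ ?_ ?_ ?_
  · intro σ _
    simp only [Finset.mem_filter, Finset.mem_univ, true_and]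
    refine ⟨hinj.comp σ.injective, ?_⟩
    rw [← Finset.image_image, Finset.image_univ_equiv, himg]
  · intro σ _ τ _ h
    ext i
    exact hinj (congrFun h i)
  · intro p hp
    simp only [Finset.mem_filter, Finset.mem_univ, true_and] at hp
    have hex : ∀ i, ∃ k, f T k = p i := by
      intro i
      have : p i ∈ Finset.univ.image (f T) := by
        rw [himg, ← hp.2]; exact Finset.mem_image_of_mem _ (Finset.mem_univ _)
      simpa using this
    choose s hs using hex
    have hsi : Function.Injective s := fun a b hab => hp.1 (by rw [← hs, ← hs, hab])
    exact ⟨Equiv.ofBijective s (Finite.injective_iff_bijective.1 hsi), Finset.mem_univ _,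
      funext hs⟩
  · intro σ _
    rfl

theorem finrank_eq_of_mem_iff_cast_mem {ι : Type*} [Finite ι] (P : Submodule ℤ (ι → ℤ))
    (Q : Submodule ℚ (ι → ℚ)) (h : ∀ v : ι → ℤ, v ∈ P ↔ (fun i => (v i : ℚ)) ∈ Q) :
    Module.finrank ℚ Q = Module.finrank ℤ P := by
  let g : P →ₗ[ℤ] Q :=
    { toFun := fun v => ⟨fun i => (v.1 i : ℚ), (h v.1).1 v.2⟩
      map_add' := fun u v => by ext; simp
      map_smul' := fun a v => by ext; simp }
  have hg : IsLocalizedModule (nonZeroDivisors ℤ) g := by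
    refine ⟨fun x => ?_, fun y => ?_, fun {x y} hxy => ⟨1, ?_⟩⟩
    · have hx : ((x : ℤ) : ℚ) ≠ 0 := by
        exact_mod_cast nonZeroDivisors.coe_ne_zero x
      rw [Module.End.isUnit_iff]
      constructor
      · intro a b hab
        simp only [Module.algebraMap_end_apply] at hab
        rw [← Int.cast_smul_eq_zsmul ℚ, ← Int.cast_smul_eq_zsmul ℚ] at hab
        exact smul_right_injective _ hx hab
      · intro a
        refine ⟨((x : ℤ) : ℚ)⁻¹ • a, ?_⟩
        simp only [Module.algebraMap_end_apply]
        rw [← Int.cast_smul_eq_zsmul ℚ, smul_inv_smul₀ hx]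
    · obtain ⟨b, hb⟩ := IsLocalization.exist_integer_multiples_of_finite
        (nonZeroDivisors ℤ) (fun i => y.1 i)
      choose w hw using hb
      have hw' : (fun i => (w i : ℚ)) = ((b : ℤ) : ℚ) • y.1 := by
        ext i
        simpa using hw i
      refine ⟨(⟨w, (h w).2 ?_⟩, b), ?_⟩
      · rw [hw']; exact Q.smul_mem _ y.2
      · ext i
        have := congrFun hw' i
        simp only [Pi.smul_apply, smul_eq_mul] at this
        simp [g, this, Submonoid.smul_def]
    · have : x = y := by
        ext i
        have := congrFun (congrArg Subtype.val hxy) i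
        simpa [g] using this
      rw [this]
  rw [← IsLocalizedModule.finrank_eq (nonZeroDivisors ℤ) g le_rfl]
  exact IsFractionRing.finrank_right_eq ℤ ℚ Q

theorem Submodule.finrank_comap_subtype_of_le {M : Type*} [AddCommGroup M]
    {L K : Submodule ℤ M} (h : L ≤ K) :
    Module.finrank ℤ (L.comap K.subtype) = Module.finrank ℤ L :=
  (Submodule.comapSubtypeEquivOfLe h).finrank_eq

theorem LinearMap.finrank_range_add_finrank_ker_int {M N : Type*} [AddCommGroup M] [AddCommGroup N]
    (f : M →ₗ[ℤ] N) [Module.Finite ℤ M] :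
    Module.finrank ℤ (LinearMap.range f) + Module.finrank ℤ (LinearMap.ker f) =
      Module.finrank ℤ M := by
  rw [← f.quotKerEquivRange.finrank_eq]
  exact (LinearMap.ker f).finrank_quotient_add_finrank

theorem LinearMap.injective_of_finrank_range_eq {M N : Type*} [AddCommGroup M] [AddCommGroup N]
    [Module.Free ℤ M] [Module.Finite ℤ M] (f : M →ₗ[ℤ] N)
    (h : Module.finrank ℤ (LinearMap.range f) = Module.finrank ℤ M) :
    Function.Injective f := by
  rw [← LinearMap.ker_eq_bot]
  have := LinearMap.finrank_range_add_finrank_ker_int f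
  exact Submodule.finrank_eq_zero.1 (by omega)

theorem linearIndependent_of_finrank_span_eq {ι M : Type*} [Fintype ι] [AddCommGroup M]
    (v : ι → M) (h : Module.finrank ℤ (Submodule.span ℤ (Set.range v)) = Fintype.card ι) :
    LinearIndependent ℤ v := by
  classical
  rw [linearIndependent_iff_injective_fintypeLinearCombination]
  apply LinearMap.injective_of_finrank_range_eq
  rw [Fintype.range_linearCombination, h, Module.finrank_pi]

theorem Matrix.natAbs_det_eq_card_quotient {m : Type*} [Fintype m] [DecidableEq m]
    (M : Matrix m m ℤ) :
    M.det.natAbs = Nat.card ((m → ℤ) ⧸ Submodule.span ℤ (Set.range M.col)) := by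
  by_cases hd : M.det = 0
  · rw [hd, Int.natAbs_zero]
    by_contra hne
    have hfin := (Nat.card_ne_zero.1 (Ne.symm hne)).2
    rw [Submodule.finiteQuotient_iff, Module.finrank_pi] at hfin
    have hli := linearIndependent_of_finrank_span_eq _ hfin
    obtain ⟨w, hw0, hw⟩ := Matrix.exists_mulVec_eq_zero_iff.2 hd
    rw [← Matrix.mulVec_injective_iff] at hli
    exact hw0 (hli (by rw [hw, Matrix.mulVec_zero]))
  · have hli : LinearIndependent ℤ M.col := by
      rw [← Matrix.mulVec_injective_iff]
      refine (injective_iff_map_eq_zero' M.mulVecLin).2 ?_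
      intro w
      refine ⟨fun h => Matrix.eq_zero_of_mulVec_eq_zero hd h, ?_⟩
      rintro rfl
      simp
    rw [← Submodule.natAbs_det_basis_change (Pi.basisFun ℤ m) _ (Module.Basis.span hli)]
    congr 1
    rw [Module.Basis.det_apply]
    congr 1
    ext i j
    have := congrFun (Module.Basis.coe_span_apply hli j) i
    simpa [Module.Basis.toMatrix_apply, Matrix.col] using this.symm

theorem Int.cast_sq_mul_cast_sq_of_natAbs_mul (R : Type*) [CommRing R] {a : ℤ} {h n k : ℕ}
    (H : a.natAbs * h = n * k) : (a : R) ^ 2 * (h : R) ^ 2 = (n : R) ^ 2 * (k : R) ^ 2 := by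
  have H2 : a ^ 2 * (h : ℤ) ^ 2 = (n : ℤ) ^ 2 * (k : ℤ) ^ 2 := by
    rw [← Int.natAbs_sq a, ← mul_pow, ← mul_pow]
    exact_mod_cast congrArg (· ^ 2) H
  exact_mod_cast congrArg (Int.cast : ℤ → R) H2

theorem Submodule.card_quotient_comap_subtype {M : Type*} [AddCommGroup M]
    (L K : Submodule ℤ M) :
    Nat.card (K ⧸ L.comap K.subtype) = L.toAddSubgroup.relIndex K.toAddSubgroup := rfl

theorem Submodule.card_quotient_eq_index {M : Type*} [AddCommGroup M] (L : Submodule ℤ M) :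
    Nat.card (M ⧸ L) = L.toAddSubgroup.index := rfl

theorem AddSubgroup.relIndex_map_ker_range {A B C : Type*} [AddCommGroup A] [AddCommGroup B]
    [AddCommGroup C] (φ : A →+ B) (p : A →+ C) (hp : Function.Surjective p) :
    (p.ker.map φ).relIndex φ.range = (φ.ker.map p).index := by
  rw [AddMonoidHom.range_eq_map, AddSubgroup.relIndex_map_map, top_sup_eq,
    AddSubgroup.relIndex_top_right, AddSubgroup.index_map, AddMonoidHom.range_eq_top.2 hp,
    AddSubgroup.index_top, mul_one, sup_comm]

/-- The minor of a family of cycles, on rows indexed by the image of `g`, is computed by the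
index of its span in the cycles and the index of the boundaries supported off these rows. -/
theorem natAbs_det_mul_card_quotient {ι m B : Type*} [Finite ι] [Fintype m] [DecidableEq m]
    [AddCommGroup B] (φ : (ι → ℤ) →ₗ[ℤ] B) (Z : Submodule ℤ B) (hZ : LinearMap.range φ ≤ Z)
    (g : m → ι) (hg : Function.Injective g)
    (hK : Module.finrank ℤ (LinearMap.ker φ) = Fintype.card m)
    (v : m → ι → ℤ) (hv : ∀ j, v j ∈ LinearMap.ker φ) :
    (Matrix.of fun i j => v j (g i)).det.natAbs *
        Nat.card (Z ⧸ (LinearMap.range φ).comap Z.subtype) =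
      Nat.card (LinearMap.ker φ ⧸
          (Submodule.span ℤ (Set.range v)).comap (LinearMap.ker φ).subtype) *
        Nat.card (Z ⧸ ((LinearMap.ker (LinearMap.funLeft ℤ ℤ g)).map φ).comap Z.subtype) := by
  set K := LinearMap.ker φ with hKdef
  set L := Submodule.span ℤ (Set.range v) with hL
  set p : (ι → ℤ) →ₗ[ℤ] (m → ℤ) := LinearMap.funLeft ℤ ℤ g with hp
  have hLK : L ≤ K := Submodule.span_le.2 (Set.range_subset_iff.2 hv)
  have hps : Function.Surjective p := LinearMap.funLeft_surjective_of_injective ℤ ℤ g hg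
  have hdet : (Matrix.of fun i j => v j (g i)).det.natAbs =
      (L.map p).toAddSubgroup.index := by
    rw [Matrix.natAbs_det_eq_card_quotient, ← Submodule.card_quotient_eq_index, hL,
      Submodule.map_span, ← Set.range_comp]
    rfl
  have hmul : (L.map p).toAddSubgroup.relIndex (K.map p).toAddSubgroup *
      (K.map p).toAddSubgroup.index = (L.map p).toAddSubgroup.index :=
    AddSubgroup.relIndex_mul_index (Submodule.map_mono hLK)
  have hproj : (L.map p).toAddSubgroup.relIndex (K.map p).toAddSubgroup *
      (K.map p).toAddSubgroup.index =
      L.toAddSubgroup.relIndex K.toAddSubgroup * (K.map p).toAddSubgroup.index := by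
    by_cases h0 : (K.map p).toAddSubgroup.index = 0
    · rw [h0, mul_zero, mul_zero]
    · congr 1
      rw [← Submodule.card_quotient_eq_index] at h0
      have hfin := (Nat.card_ne_zero.1 h0).2
      rw [Submodule.finiteQuotient_iff, Module.finrank_pi, ← hK] at hfin
      have hinj : Function.Injective (p.domRestrict K) := by
        apply LinearMap.injective_of_finrank_range_eq
        rw [LinearMap.range_domRestrict, hfin]
      have := AddSubgroup.relIndex_map_map_of_injective
        (L.comap K.subtype).toAddSubgroup ⊤ (f := (p.domRestrict K).toAddMonoidHom) hinj
      rw [AddSubgroup.relIndex_top_right, ← Submodule.card_quotient_eq_index] at this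
      rw [← Submodule.card_quotient_comap_subtype L K, ← this]
      congr 1
      · change _ = ((L.comap K.subtype).map (p ∘ₗ K.subtype)).toAddSubgroup
        rw [Submodule.map_comp, Submodule.map_comap_subtype, inf_eq_right.2 hLK]
      · change _ = ((⊤ : Submodule ℤ K).map (p ∘ₗ K.subtype)).toAddSubgroup
        rw [Submodule.map_comp, Submodule.map_subtype_top]
  have hcomp : (K.map p).toAddSubgroup.index *
      (LinearMap.range φ).toAddSubgroup.relIndex Z.toAddSubgroup =
      ((LinearMap.ker p).map φ).toAddSubgroup.relIndex Z.toAddSubgroup := by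
    rw [← AddSubgroup.relIndex_mul_relIndex _ _ _
      (show ((LinearMap.ker p).map φ).toAddSubgroup ≤ (LinearMap.range φ).toAddSubgroup from
        LinearMap.map_le_range) hZ]
    congr 1
    exact (AddSubgroup.relIndex_map_ker_range φ.toAddMonoidHom p.toAddMonoidHom hps).symm
  rw [Submodule.card_quotient_comap_subtype, Submodule.card_quotient_comap_subtype,
    Submodule.card_quotient_comap_subtype, hdet, ← hmul, hproj, mul_assoc, hcomp]

theorem ker_funLeft_eq_span {ι m : Type*} [Fintype ι] [DecidableEq ι] (g : m → ι)
    (U : Finset ι) (hU : ∀ i, i ∈ U ↔ i ∉ Set.range g) :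
    LinearMap.ker (LinearMap.funLeft ℤ ℤ g) =
      Submodule.span ℤ ((fun i => Pi.single i (1 : ℤ)) '' (U : Set ι)) := by
  apply le_antisymm
  · intro w hw
    have hw' : ∀ k, w (g k) = 0 := fun k => congrFun hw k
    rw [pi_eq_sum_univ' w]
    refine Submodule.sum_mem _ fun i _ => ?_
    by_cases hi : i ∈ U
    · refine Submodule.smul_mem _ _ (Submodule.subset_span ⟨i, hi, ?_⟩)
      ext j
      simp [Pi.single_apply, eq_comm]
    · rw [hU, not_not] at hi
      obtain ⟨k, rfl⟩ := hi
      rw [hw', zero_smul]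
      exact Submodule.zero_mem _
  · rw [Submodule.span_le]
    rintro _ ⟨i, hi, rfl⟩
    ext k
    have : g k ≠ i := fun h => (hU i).1 hi ⟨k, h⟩
    simp [LinearMap.funLeft_apply, this]

namespace CellStructure

section

variable {d : ℕ} (X : CellStructure d)

theorem range_bdry_le_Zker (i : ℕ) : LinearMap.range (X.bdry i) ≤ X.Zker i := by
  rintro _ ⟨w, rfl⟩
  cases i with
  | zero =>
    change ∑ i, (X.D 0).mulVec w i = 0
    simp only [Matrix.mulVec, dotProduct]
    rw [Finset.sum_comm]
    simp [← Finset.sum_mul, X.colsum]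
  | succ i =>
    change (X.D i).mulVec ((X.D (i + 1)).mulVec w) = 0
    rw [Matrix.mulVec_mulVec, X.dd, Matrix.zero_mulVec]

theorem finrank_ZkerQ (i : ℕ) : Module.finrank ℚ (X.ZkerQ i) = Module.finrank ℤ (X.Zker i) := by
  apply finrank_eq_of_mem_iff_cast_mem
  intro v
  cases i with
  | zero =>
    change ∑ i, v i = 0 ↔ ∑ i, (v i : ℚ) = 0
    exact_mod_cast Iff.rfl
  | succ i =>
    change (X.D i).mulVec v = 0 ↔ ((X.D i).map (Int.cast : ℤ → ℚ)).mulVec (fun j => (v j : ℚ)) = 0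
    simp only [funext_iff, Matrix.mulVec, dotProduct, Matrix.map_apply, Pi.zero_apply]
    exact_mod_cast Iff.rfl

theorem finrank_range_bdry_add_finrank_Zker (i : ℕ) :
    Module.finrank ℤ (LinearMap.range (X.bdry i)) + Module.finrank ℤ (X.Zker (i + 1)) =
      X.c (i + 1) := by
  simpa using! LinearMap.finrank_range_add_finrank_ker_int (X.bdry i)

theorem finrank_range_bdry_add_beta (i : ℕ) :
    X.beta i + Module.finrank ℤ (LinearMap.range (X.bdry i)) = Module.finrank ℤ (X.Zker i) := by
  rw [← Submodule.finrank_comap_subtype_of_le (X.range_bdry_le_Zker i)]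
  exact Submodule.finrank_quotient_add_finrank _

theorem finrank_Zker_zero : 1 + Module.finrank ℤ (X.Zker 0) = X.c 0 := by
  have h := LinearMap.finrank_range_add_finrank_ker_int X.aug
  have hs : LinearMap.range X.aug = ⊤ := by
    rw [LinearMap.range_eq_top]
    intro a
    refine ⟨Pi.single ⟨0, X.c_pos 0 (Nat.zero_le d)⟩ a, ?_⟩
    simp [aug]
  rw [hs, finrank_top, Module.finrank_self] at h
  simpa using! h

theorem colSpan_eq_span_range (j : ℕ) (T : Finset (Fin (X.c (j + 1)))) :
    X.colSpan j T = Submodule.span ℤ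
      (Set.range fun t : {f // f ∈ T} => (X.D j)ᵀ (t : Fin (X.c (j + 1)))) := by
  rw [colSpan, Set.image_eq_range]
  rfl

theorem col_mem_Zker (j : ℕ) (t : Fin (X.c (j + 1))) : (X.D j)ᵀ t ∈ X.Zker j := by
  apply X.range_bdry_le_Zker
  refine ⟨Pi.single t 1, ?_⟩
  ext i
  simp [bdry]

theorem colSpan_le_Zker (j : ℕ) (T : Finset (Fin (X.c (j + 1)))) : X.colSpan j T ≤ X.Zker j := by
  rw [colSpan_eq_span_range, Submodule.span_le, Set.range_subset_iff]
  exact fun t => X.col_mem_Zker j t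

theorem isTree_iff (j : ℕ) (T : Finset (Fin (X.c (j + 1)))) :
    X.IsTree j T ↔ T.card = Module.finrank ℤ (X.Zker j) ∧ Nat.card (X.Hsub j T) ≠ 0 := by
  rw [IsTree, finrank_ZkerQ]
  refine ⟨fun h => ⟨h.2.2, h.2.1⟩, fun ⟨h1, h2⟩ => ⟨?_, h2, h1⟩⟩
  have hfin := (Nat.card_ne_zero.1 h2).2
  rw [Submodule.finiteQuotient_iff,
    Submodule.finrank_comap_subtype_of_le (X.colSpan_le_Zker j T), ← h1,
    colSpan_eq_span_range] at hfin
  apply linearIndependent_of_finrank_span_eq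
  rw [hfin, Fintype.card_coe]

theorem tau_succ (j : ℕ) :
    X.tau (j + 1) = ∑ T ∈ Finset.univ.powersetCard (Module.finrank ℤ (X.Zker j)),
      Nat.card (X.Hsub j T) ^ 2 := by
  classical
  rw [tau, Finset.powersetCard_eq_filter, Finset.powerset_univ, Finset.sum_filter]
  refine Finset.sum_congr rfl fun T _ => ?_
  simp only [isTree_iff]
  grind

theorem tau_eq_sum (i : ℕ) (h : ∀ j, j < i → X.beta j = 0) :
    X.tau i = ∑ U ∈ Finset.univ.powersetCard (X.c i - Module.finrank ℤ (X.Zker i)),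
      Nat.card (X.HsubG i U) ^ 2 := by
  cases i with
  | zero =>
    have h1 : X.c 0 - Module.finrank ℤ (X.Zker 0) = 1 := by
      have := X.finrank_Zker_zero
      omega
    rw [h1, tau]
    have : ∀ U ∈ (Finset.univ : Finset (Fin (X.c 0))).powersetCard 1,
        Nat.card (X.HsubG 0 U) ^ 2 = 1 := by
      intro U hU
      obtain ⟨u, rfl⟩ := Finset.card_eq_one.1 (Finset.mem_powersetCard.1 hU).2
      have : Submodule.span ℤ ((fun _ => (1 : ℤ)) ''
          (({u} : Finset (Fin (X.c 0))) : Set (Fin (X.c 0)))) = ⊤ := by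
        simp [Ideal.span_singleton_one]
      rw [HsubG, this]
      simp
    rw [Finset.sum_congr rfl this]
    simp
  | succ j =>
    rw [tau_succ]
    have h1 := X.finrank_range_bdry_add_finrank_Zker j
    have h2 := X.finrank_range_bdry_add_beta j
    rw [h j j.lt_succ_self] at h2
    rw [show X.c (j + 1) - Module.finrank ℤ (X.Zker (j + 1)) = Module.finrank ℤ (X.Zker j) by
      omega]
    rfl

/-- A maximal minor of `∂_{e+1}`, with rows the image of `g` and columns `f`, in terms of the
homology of the subcomplexes given by `T = range f` and `U`, the complement of `range g`. -/
theorem natAbs_det_mul_card_Hred {m : Type*} [Fintype m] [DecidableEq m] (e : ℕ)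
    (hm : Module.finrank ℤ (X.Zker e) = Fintype.card m)
    (g : m → Fin (X.c e)) (hg : Function.Injective g) (U : Finset (Fin (X.c e)))
    (hU : ∀ i, i ∈ U ↔ i ∉ Set.range g)
    (f : m → Fin (X.c (e + 1))) (T : Finset (Fin (X.c (e + 1)))) (hT : Set.range f = T) :
    ((X.D e).submatrix g f).det.natAbs * Nat.card (X.Hred e) =
      Nat.card (X.Hsub e T) * Nat.card (X.HsubG e U) := by
  have hspan : X.colSpan e T = Submodule.span ℤ (Set.range fun j => (X.D e)ᵀ (f j)) := by
    rw [colSpan, ← hT, ← Set.range_comp]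
    rfl
  rw [Hsub, hspan]
  cases e with
  | zero =>
    have := natAbs_det_mul_card_quotient X.aug ⊤ le_top g hg hm (fun j => (X.D 0)ᵀ (f j))
      (fun j => X.col_mem_Zker 0 (f j))
    rw [ker_funLeft_eq_span g U hU, Submodule.map_span, ← Set.image_comp] at this
    have h1 : (X.aug ∘ fun i => Pi.single i (1 : ℤ)) = fun _ => 1 := by
      ext i
      simp [aug]
    rw [h1] at this
    simp only [Submodule.card_quotient_comap_subtype (K := (⊤ : Submodule ℤ ℤ)),
      Submodule.top_toAddSubgroup, AddSubgroup.relIndex_top_right,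
      ← Submodule.card_quotient_eq_index] at this
    exact this
  | succ i =>
    have := natAbs_det_mul_card_quotient (X.bdry i) (X.Zker i) (X.range_bdry_le_Zker i) g hg hm
      (fun j => (X.D (i + 1))ᵀ (f j)) (fun j => X.col_mem_Zker (i + 1) (f j))
    rw [ker_funLeft_eq_span g U hU, Submodule.map_span, ← Set.image_comp] at this
    have h1 : (X.bdry i ∘ fun j => Pi.single j (1 : ℤ)) = fun t => (X.D i)ᵀ t := by
      ext j k
      simp [bdry]
    rw [h1] at this
    exact this

end

variable {e : ℕ} (X : CellStructure (e + 1))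

theorem beta_top : X.beta (e + 1) = Module.finrank ℤ (X.Zker (e + 1)) := by
  have h := X.finrank_range_bdry_add_beta (e + 1)
  have h2 := X.finrank_range_bdry_add_finrank_Zker (e + 1)
  have h3 := X.c_zero (e + 1 + 1) (Nat.lt_succ_self _)
  omega

theorem wtau_eq_sum :
    X.wtau = ∑ T ∈ Finset.univ.powersetCard (Module.finrank ℤ (X.Zker e)),
      (Nat.card (X.Hsub e T) : MvPolynomial (Fin (X.c (e + 1))) ℤ) ^ 2 *
        ∏ f ∈ T, (MvPolynomial.X f) ^ 2 := by
  classical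
  rw [wtau, Finset.powersetCard_eq_filter, Finset.powerset_univ, Finset.sum_filter]
  refine Finset.sum_congr rfl fun T _ => ?_
  simp only [isTree_iff]
  by_cases h : Nat.card (X.Hsub e T) = 0 <;> simp [h]

theorem det_wD_submatrix {m : Type*} [Fintype m] [DecidableEq m] (g : m → Fin (X.c e))
    (f : m → Fin (X.c (e + 1))) :
    (X.wD.submatrix g f).det =
      (((X.D e).submatrix g f).det : MvPolynomial (Fin (X.c (e + 1))) ℤ) *
        ∏ k, MvPolynomial.X (f k) := by
  have h : X.wD.submatrix g f =
      (((X.D e).submatrix g f).map (Int.castRingHom (MvPolynomial (Fin (X.c (e + 1))) ℤ))) *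
        Matrix.diagonal fun k => MvPolynomial.X (f k) := by
    ext1 i j
    simp [wD, Matrix.mul_diagonal]
  rw [h, Matrix.det_mul, Matrix.det_diagonal, ← RingHom.mapMatrix_apply, ← RingHom.map_det]
  rfl

theorem det_wLud_submatrix_mul (r : ℕ) (hr : Module.finrank ℤ (X.Zker e) = r)
    (S : Finset (Fin (X.c e))) (hS : S.card = r) :
    (X.wLud.submatrix (Subtype.val : S → Fin (X.c e)) (Subtype.val : S → Fin (X.c e))).det *
        (Nat.card (X.Hred e) : MvPolynomial (Fin (X.c (e + 1))) ℤ) ^ 2 =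
      X.wtau * (Nat.card (X.HsubG e Sᶜ) : MvPolynomial (Fin (X.c (e + 1))) ℤ) ^ 2 := by
  have hcard : Fintype.card S = r := by rw [Fintype.card_coe, hS]
  have hex : ∀ T : Finset (Fin (X.c (e + 1))), ∃ f : S → Fin (X.c (e + 1)),
      T.card = Fintype.card S → Function.Injective f ∧ Finset.univ.image f = T := by
    intro T
    by_cases h : T.card = Fintype.card S
    · have σ : S ≃ T := Fintype.equivOfCardEq (by rw [Fintype.card_coe T, h])
      refine ⟨fun s => σ s, fun _ => ⟨Subtype.val_injective.comp σ.injective, ?_⟩⟩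
      ext t
      simp only [Finset.mem_image, Finset.mem_univ, true_and]
      exact ⟨fun ⟨a, ha⟩ => ha ▸ (σ a).2, fun ht => ⟨σ.symm ⟨t, ht⟩, by simp⟩⟩
    · exact ⟨fun _ => ⟨0, X.c_pos _ le_rfl⟩, fun h' => absurd h' h⟩
  choose f hf using hex
  have hsub : X.wLud.submatrix (Subtype.val : S → Fin (X.c e)) (Subtype.val : S → Fin (X.c e)) =
      X.wD.submatrix (Subtype.val : S → Fin (X.c e)) id *
        X.wDᵀ.submatrix id (Subtype.val : S → Fin (X.c e)) := by
    rw [wLud, ← Matrix.submatrix_mul_equiv _ _ _ (Equiv.refl _) _]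
    rfl
  rw [hsub, Matrix.det_mul_eq_sum_det_mul_det _ _ f hf, wtau_eq_sum, Finset.sum_mul,
    Finset.sum_mul, hr, hcard]
  refine Finset.sum_congr rfl fun T hT => ?_
  obtain ⟨hinj, himg⟩ := hf T (by rw [hcard, (Finset.mem_powersetCard.1 hT).2])
  have key := X.natAbs_det_mul_card_Hred e (hr.trans hcard.symm) (Subtype.val : S → Fin (X.c e))
    Subtype.val_injective Sᶜ (by simp) (f T) T
    (by
      simpa using congrArg
        (fun s : Finset (Fin (X.c (e + 1))) => (s : Set (Fin (X.c (e + 1))))) himg)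
  have hsq := Int.cast_sq_mul_cast_sq_of_natAbs_mul (MvPolynomial (Fin (X.c (e + 1))) ℤ) key
  have h1 : ((X.wD.submatrix (Subtype.val : S → Fin (X.c e)) id).submatrix id (f T)).det =
      (X.wD.submatrix (Subtype.val : S → Fin (X.c e)) (f T)).det := rfl
  have h2 : ((X.wDᵀ.submatrix id (Subtype.val : S → Fin (X.c e))).submatrix (f T) id).det =
      (X.wD.submatrix (Subtype.val : S → Fin (X.c e)) (f T)).det :=
    Matrix.det_transpose (X.wD.submatrix (Subtype.val : S → Fin (X.c e)) (f T))
  have h3 : ∏ k, (MvPolynomial.X (f T k) : MvPolynomial (Fin (X.c (e + 1))) ℤ) =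
      ∏ t ∈ T, MvPolynomial.X t := by
    conv_rhs => rw [← himg]
    rw [Finset.prod_image hinj.injOn]
  rw [h1, h2, det_wD_submatrix, h3, Finset.prod_pow]
  linear_combination (∏ t ∈ T, MvPolynomial.X t) ^ 2 * hsq

end CellStructure

/-- **Weighted Cellular Matrix-Tree Theorem, part (1)** (Duval–Klivans–Martin).
With `r = |X_d| - β_d(X)`, the coefficient `c` of `y^{|X_{d-1}| - r}` in the
characteristic polynomial `det(y·I - L̂)` satisfies
`c · |H_{d-2}(X)|² = (-1)^r · τ̂_d(X) · τ_{d-1}(X)` in `R = ℤ[x_f : f ∈ X_d]`. -/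
theorem weighted_cellular_matrix_tree_theorem_part1
    (e : ℕ) (X : CellStructure (e + 1)) (hAPC : X.APC) :
    (X.wLud.charpoly.coeff (X.c e - (X.c (e + 1) - X.beta (e + 1)))) *
        (Nat.card (X.Hred e) : MvPolynomial (Fin (X.c (e + 1))) ℤ) ^ 2 =
      (-1) ^ (X.c (e + 1) - X.beta (e + 1)) * X.wtau *
        (X.tau e : MvPolynomial (Fin (X.c (e + 1))) ℤ) := by
  have h1 := X.finrank_range_bdry_add_finrank_Zker e
  have h2 := X.finrank_range_bdry_add_beta e
  rw [hAPC e e.lt_succ_self] at h2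
  rw [X.beta_top]
  obtain ⟨r, hr⟩ : ∃ r, Module.finrank ℤ (X.Zker e) = r := ⟨_, rfl⟩
  have hre : X.c (e + 1) - Module.finrank ℤ (X.Zker (e + 1)) = r := by omega
  have hrc : r ≤ Fintype.card (Fin (X.c e)) := by
    have := (X.Zker e).finrank_le
    rwa [hr, Module.finrank_pi] at this
  have hcoeff := X.wLud.charpoly_coeff_eq_sum_minors r hrc
  rw [Fintype.card_fin] at hcoeff hrc
  rw [hre, hcoeff, X.tau_eq_sum e (fun j hj => hAPC j (hj.trans e.lt_succ_self)), hr, mul_assoc,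
    mul_assoc]
  congr 1
  rw [Finset.sum_mul, Nat.cast_sum, Finset.mul_sum]
  refine Finset.sum_bij' (fun (S : Finset (Fin (X.c e))) _ => Sᶜ)
    (fun (U : Finset (Fin (X.c e))) _ => Uᶜ) ?_ ?_
    (fun (S : Finset (Fin (X.c e))) _ => compl_compl S)
    (fun (U : Finset (Fin (X.c e))) _ => compl_compl U) ?_
  · intro S hS
    simp only [Finset.mem_powersetCard_univ] at hS ⊢
    rw [Finset.card_compl, Fintype.card_fin, hS]
  · intro U hU
    simp only [Finset.mem_powersetCard_univ] at hU ⊢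
    rw [Finset.card_compl, Fintype.card_fin, hU]
    omega
  · intro S hS
    rw [X.det_wLud_submatrix_mul r hr S (Finset.mem_powersetCard.1 hS).2, Nat.cast_pow]
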